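/- arXiv:2101.12178 — 9 statements merged into one kernel-verified Lean document; each statement's English description precedes it below -/
import Mathlib

section
/- Let p, q ≥ 2 be integers with (p,q) ≠ (2,2), and let ℓ ≥ 1 divide both p and q; set N = (pq − p − q)/ℓ (an integer since ℓ divides p and q). Then the permutation of ZMod N given by c ↦ c − p has exactly gcd(q, (p+q)/ℓ) orbits, and every orbit has cardinality (pq − p − q)/gcd(ℓ·q, p+q). In particular gcd(N, p) = gcd(q, (p+q)/ℓ) = gcd(p, (p+q)/ℓ). -/
theorem Equiv.subRight_zpow_apply {G : Type*} [AddCommGroup G] (a x : G) (n : ℤ) :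
    ((Equiv.subRight a) ^ n) x = x - n • a := by
  induction n with
  | zero => simp
  | succ n ih => rw [add_comm, zpow_add, Equiv.Perm.mul_apply, ih]; simp [add_smul]; abel
  | pred n ih =>
    rw [sub_eq_neg_add, zpow_add, Equiv.Perm.mul_apply, ih, zpow_neg_one, Equiv.Perm.inv_def,
      Equiv.symm_apply_eq]
    simp [add_smul]
    abel

theorem mem_orbit_zpowers_subRight {G : Type*} [AddCommGroup G] (a x y : G) :
    y ∈ MulAction.orbit (Subgroup.zpowers (Equiv.subRight a)) x ↔
      -x + y ∈ AddSubgroup.zmultiples a := by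
  rw [AddSubgroup.mem_zmultiples_iff]
  constructor
  · rintro ⟨⟨_, n, rfl⟩, rfl⟩
    exact ⟨-n, by simp [Subgroup.smul_def, Equiv.subRight_zpow_apply]; abel⟩
  · rintro ⟨n, hn⟩
    refine ⟨⟨_, -n, rfl⟩, ?_⟩
    simp [Subgroup.smul_def, Equiv.subRight_zpow_apply, -zpow_neg, hn]

theorem card_orbit_zpowers_subRight {G : Type*} [AddCommGroup G] (a x : G) :
    Nat.card (MulAction.orbit (Subgroup.zpowers (Equiv.subRight a)) x) = addOrderOf a := by
  rw [← Nat.card_zmultiples]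
  exact Nat.card_congr <| (Equiv.addLeft (-x)).subtypeEquiv fun y =>
    mem_orbit_zpowers_subRight a x y

theorem card_orbits_zpowers_subRight {G : Type*} [AddCommGroup G] (a : G) :
    Nat.card (MulAction.orbitRel.Quotient (Subgroup.zpowers (Equiv.subRight a)) G) =
      (AddSubgroup.zmultiples a).index :=
  Nat.card_congr <| Quotient.congrRight fun x y => by
    rw [MulAction.orbitRel_apply, MulAction.mem_orbit_symm, mem_orbit_zpowers_subRight,
      QuotientAddGroup.leftRel_apply]

theorem ZMod.index_zmultiples_natCast {N : ℕ} (hN : N ≠ 0) (a : ℕ) :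
    (AddSubgroup.zmultiples (a : ZMod N)).index = N.gcd a := by
  have h := (AddSubgroup.zmultiples (a : ZMod N)).index_mul_card
  rw [Nat.card_zmultiples, ZMod.addOrderOf_coe a hN, Nat.card_zmod] at h
  have hg := Nat.mul_div_cancel' (Nat.gcd_dvd_left N a)
  refine Nat.eq_of_mul_eq_mul_right (Nat.pos_of_ne_zero fun h0 => hN ?_) (h.trans hg.symm)
  rw [← hg, h0, mul_zero]

theorem Nat.gcd_mul_add_comm (l a b : ℕ) : (l * a).gcd (a + b) = (l * b).gcd (a + b) := by
  have key (c d : ℕ) : (l * c).gcd (c + d) ∣ (l * d).gcd (c + d) := by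
    refine Nat.dvd_gcd ?_ (Nat.gcd_dvd_right ..)
    refine (Nat.dvd_add_right (Nat.gcd_dvd_left (l * c) (c + d))).1 ?_
    rw [← mul_add]
    exact (Nat.gcd_dvd_right ..).mul_left l
  refine Nat.dvd_antisymm (key a b) ?_
  simpa only [add_comm b a] using key b a

theorem Nat.gcd_eq_of_add_eq_mul {n s m b : ℕ} (h : n + s = m * b) : n.gcd m = m.gcd s := by
  rw [Nat.gcd_comm]
  apply Nat.dvd_antisymm <;> refine Nat.dvd_gcd (Nat.gcd_dvd_left ..) ?_
  · refine (Nat.dvd_add_right (Nat.gcd_dvd_right m n)).1 ?_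
    rw [h]
    exact (Nat.gcd_dvd_left ..).mul_right b
  · refine (Nat.dvd_add_left (Nat.gcd_dvd_right m s)).1 ?_
    rw [h]
    exact (Nat.gcd_dvd_left ..).mul_right b

/-- For `p, q ≥ 2` with `(p,q) ≠ (2,2)`, `ℓ ∣ p`, `ℓ ∣ q` and
`N = (pq − p − q)/ℓ`, the permutation `c ↦ c − p` of `ZMod N` has exactly
`gcd(q, (p+q)/ℓ)` orbits, each of cardinality `(pq − p − q)/gcd(ℓq, p+q)`; moreover
`gcd(N, p) = gcd(q, (p+q)/ℓ) = gcd(p, (p+q)/ℓ)`. -/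
theorem brieskorn_pham_orbit_count
    (p q ℓ N : ℕ) (hp : 2 ≤ p) (hq : 2 ≤ q) (hpq : (p, q) ≠ (2, 2)) (hℓ : 1 ≤ ℓ)
    (hℓp : ℓ ∣ p) (hℓq : ℓ ∣ q) (hN : N = (p * q - p - q) / ℓ) :
    Nat.card (MulAction.orbitRel.Quotient
        (Subgroup.zpowers (Equiv.subRight ((p : ℕ) : ZMod N))) (ZMod N))
      = Nat.gcd q ((p + q) / ℓ) ∧
    (∀ x : ZMod N,
      Nat.card (MulAction.orbit
          (Subgroup.zpowers (Equiv.subRight ((p : ℕ) : ZMod N))) x)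
        = (p * q - p - q) / Nat.gcd (ℓ * q) (p + q)) ∧
    Nat.gcd N p = Nat.gcd q ((p + q) / ℓ) ∧
    Nat.gcd q ((p + q) / ℓ) = Nat.gcd p ((p + q) / ℓ) := by
  obtain ⟨a, rfl⟩ := hℓp
  obtain ⟨b, rfl⟩ := hℓq
  have hpos : ℓ * a + ℓ * b < ℓ * a * (ℓ * b) := by
    have hne : 2 < ℓ * a ∨ 2 < ℓ * b := by
      by_contra! hle
      exact hpq (Prod.ext (by simp; omega) (by simp; omega))
    rcases hne with h | h <;> nlinarith
  have hsub : ℓ * a * (ℓ * b) - ℓ * a - ℓ * b = ℓ * (ℓ * a * b - (a + b)) := by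
    rw [Nat.sub_sub, ← mul_add, Nat.mul_sub]
    congr 1
    ring
  rw [hsub, Nat.mul_div_cancel_left _ hℓ] at hN
  have hs : (ℓ * a + ℓ * b) / ℓ = a + b := by rw [← mul_add, Nat.mul_div_cancel_left _ hℓ]
  have hlt : a + b < ℓ * a * b := by
    refine Nat.lt_of_mul_lt_mul_left (a := ℓ) ?_
    convert hpos using 1 <;> ring
  have hN0 : N ≠ 0 := by omega
  have hsymm := Nat.gcd_mul_add_comm ℓ a b
  have hgcd : N.gcd (ℓ * a) = (ℓ * b).gcd (a + b) :=
    (Nat.gcd_eq_of_add_eq_mul (by omega : N + (a + b) = ℓ * a * b)).trans hsymm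
  rw [hs, hsub, ← hN]
  refine ⟨?_, fun x => ?_, hgcd, hsymm.symm⟩
  · rw [card_orbits_zpowers_subRight, ZMod.index_zmultiples_natCast hN0, hgcd]
  · rw [card_orbit_zpowers_subRight, ZMod.addOrderOf_coe _ hN0, hgcd, ← mul_add, Nat.gcd_mul_left,
      Nat.mul_div_mul_left _ _ hℓ]
end

section
/- Let p, q ≥ 2 be integers and let ℓ ≥ 1 divide both p − 1 and q − 1. Define a map f on the finite set {0,…,(p−1)/ℓ − 1} × {0,…,q−2} by f(k, i) = (k′, i′), where k′ = (k − 1) mod ((p−1)/ℓ) and i′ = (i − 1 + ((q−1)/ℓ)·⌊(k−1)·ℓ/(p−1)⌋) mod (q−1), with k, i regarded as integers, ⌊·⌋ the integer floor, and a mod n the unique representative of a in {0,…,n−1}. Then f is a bijection, f has exactly gcd(q−1, (p+q−2)/ℓ) orbits, and every orbit of f has cardinality (p−1)(q−1)/gcd(ℓ·(q−1), p+q−2). -/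
/-- The surjection `(K, i) ↦ (K mod a, i + b ⌊K / a⌋)` from the strip `ℤ × ZMod n`, which turns the
twisted translation of `ZMod a × ZMod n` into an honest translation. -/
def stripMap (a b n : ℕ) (K : ℤ) (i : ZMod n) : ZMod a × ZMod n :=
  ((K : ZMod a), i + (b : ZMod n) * ((K / (a : ℤ) : ℤ) : ZMod n))

theorem stripMap_val {a b n : ℕ} [NeZero a] (x : ZMod a × ZMod n) :
    stripMap a b n (x.1.val : ℤ) x.2 = x := by
  have h : ((x.1.val : ℤ) / (a : ℤ)) = 0 :=
    Int.ediv_eq_zero_of_lt (by positivity) (by exact_mod_cast ZMod.val_lt x.1)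
  rw [stripMap, h]
  simp

section TwistedTranslation

variable {a b n : ℕ} [NeZero a] {e : Equiv.Perm (ZMod a × ZMod n)}

theorem apply_stripMap
    (he : ∀ x, e x = (x.1 - 1, x.2 - 1 + (b : ZMod n) * ((((x.1.val : ℤ) - 1) / (a : ℤ) : ℤ))))
    (K : ℤ) (i : ZMod n) : e (stripMap a b n K i) = stripMap a b n (K - 1) (i - 1) := by
  have ha : (a : ℤ) ≠ 0 := by exact_mod_cast NeZero.ne a
  have hdiv : (K - 1) / (a : ℤ) = K / a + (K % a - 1) / a := by
    have h : K - 1 = (K % a - 1) + a * (K / a) := by linarith [Int.emod_add_mul_ediv K a]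
    rw [h, Int.add_mul_ediv_left _ _ ha, add_comm]
  rw [he]
  simp only [stripMap, ZMod.val_intCast, hdiv]
  ext
  · simp
  · push_cast
    ring

theorem iterate_stripMap
    (he : ∀ x, e x = (x.1 - 1, x.2 - 1 + (b : ZMod n) * ((((x.1.val : ℤ) - 1) / (a : ℤ) : ℤ))))
    (m : ℕ) (K : ℤ) (i : ZMod n) :
    e^[m] (stripMap a b n K i) = stripMap a b n (K - m) (i - m) := by
  induction m with
  | zero => simp
  | succ m ih =>
    rw [Function.iterate_succ_apply', ih, apply_stripMap he]
    congr 1 <;> push_cast <;> ring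

theorem isPeriodicPt_iff_dvd [NeZero n]
    (he : ∀ x, e x = (x.1 - 1, x.2 - 1 + (b : ZMod n) * ((((x.1.val : ℤ) - 1) / (a : ℤ) : ℤ))))
    (x : ZMod a × ZMod n) (m : ℕ) :
    Function.IsPeriodicPt e m x ↔ a * (n / n.gcd (a + b)) ∣ m := by
  have ha : (a : ℤ) ≠ 0 := by exact_mod_cast NeZero.ne a
  have hgpos : 0 < n.gcd (a + b) := Nat.gcd_pos_of_pos_left _ (NeZero.pos n)
  have hmul (t : ℕ) : n ∣ t * (a + b) ↔ n / n.gcd (a + b) ∣ t := by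
    have hcop := Nat.coprime_div_gcd_div_gcd hgpos
    have hd := Nat.mul_div_cancel' (Nat.gcd_dvd_left n (a + b))
    have hc := Nat.mul_div_cancel' (Nat.gcd_dvd_right n (a + b))
    rw [← hcop.dvd_mul_right, ← Nat.mul_dvd_mul_iff_left hgpos (b := n / _), hd, mul_left_comm, hc]
  have key : Function.IsPeriodicPt e m x ↔ a ∣ m ∧ n ∣ m / a * (a + b) := by
    rw [Function.IsPeriodicPt, Function.IsFixedPt]
    conv_lhs => rw [← stripMap_val (b := b) x, iterate_stripMap he]
    rw [stripMap, stripMap, Prod.mk.injEq]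
    have h1 : (((x.1.val : ℤ) - m : ℤ) : ZMod a) = ((x.1.val : ℤ) : ZMod a) ↔ a ∣ m := by
      push_cast
      rw [sub_eq_self, ZMod.natCast_eq_zero_iff]
    rw [h1]
    refine and_congr_right ?_
    rintro ⟨t, rfl⟩
    have h2 : ((x.1.val : ℤ) - (a * t : ℕ)) / (a : ℤ) = (x.1.val : ℤ) / a - t := by
      rw [show ((x.1.val : ℤ) - (a * t : ℕ)) = x.1.val + a * (-t : ℤ) by push_cast; ring,
        Int.add_mul_ediv_left _ _ ha]
      ring
    rw [h2, Nat.mul_div_cancel_left _ (NeZero.pos a), ← ZMod.natCast_eq_zero_iff,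
      ← sub_eq_zero, ← neg_eq_zero]
    push_cast
    ring_nf
  rw [key]
  constructor
  · rintro ⟨⟨t, rfl⟩, h⟩
    rw [Nat.mul_div_cancel_left _ (NeZero.pos a), hmul] at h
    exact Nat.mul_dvd_mul_left a h
  · intro h
    obtain ⟨t, rfl⟩ := dvd_of_mul_right_dvd h
    rw [Nat.mul_div_cancel_left _ (NeZero.pos a), hmul]
    exact ⟨Dvd.intro _ rfl, Nat.dvd_of_mul_dvd_mul_left (NeZero.pos a) h⟩

theorem card_orbit_zpowers [NeZero n]
    (he : ∀ x, e x = (x.1 - 1, x.2 - 1 + (b : ZMod n) * ((((x.1.val : ℤ) - 1) / (a : ℤ) : ℤ))))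
    (x : ZMod a × ZMod n) :
    Nat.card (MulAction.orbit (Subgroup.zpowers e) x) = a * (n / n.gcd (a + b)) := by
  classical
  have : Fintype (MulAction.orbit (Subgroup.zpowers e) x) := Fintype.ofFinite _
  rw [Nat.card_eq_fintype_card, ← MulAction.minimalPeriod_eq_card]
  change Function.minimalPeriod e x = _
  refine Nat.dvd_antisymm ?_ ?_
  · exact ((isPeriodicPt_iff_dvd he x _).2 dvd_rfl).minimalPeriod_dvd
  · exact (isPeriodicPt_iff_dvd he x _).1 (Function.isPeriodicPt_minimalPeriod e x)

theorem card_orbitRel_quotient_zpowers [NeZero n]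
    (he : ∀ x, e x = (x.1 - 1, x.2 - 1 + (b : ZMod n) * ((((x.1.val : ℤ) - 1) / (a : ℤ) : ℤ)))) :
    Nat.card (MulAction.orbitRel.Quotient (Subgroup.zpowers e) (ZMod a × ZMod n))
      = n.gcd (a + b) := by
  classical
  have : Fintype (MulAction.orbitRel.Quotient (Subgroup.zpowers e) (ZMod a × ZMod n)) :=
    Fintype.ofFinite _
  have hcard := Nat.card_congr
    (MulAction.selfEquivSigmaOrbits (Subgroup.zpowers e) (ZMod a × ZMod n))
  rw [Nat.card_sigma] at hcard
  simp only [card_orbit_zpowers he, Finset.sum_const, Finset.card_univ, smul_eq_mul,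
    Nat.card_prod, Nat.card_zmod, ← Nat.card_eq_fintype_card] at hcard
  obtain ⟨d, hd⟩ := Nat.gcd_dvd_left n (a + b)
  have hn := NeZero.pos n
  have hgpos : 0 < n.gcd (a + b) := Nat.gcd_pos_of_pos_left _ hn
  have hdpos : 0 < d := by
    by_contra! h
    obtain rfl : d = 0 := by omega
    omega
  have hdiv : n / n.gcd (a + b) = d := Nat.div_eq_of_eq_mul_right hgpos hd
  rw [hdiv] at hcard
  refine Nat.eq_of_mul_eq_mul_right (Nat.mul_pos (NeZero.pos a) hdpos) ?_
  rw [← hcard]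
  conv_lhs => rw [hd]
  ring

end TwistedTranslation


/-- For `p, q ≥ 2` and `ℓ ≥ 1` dividing both `p − 1` and `q − 1`,
the map `f(k, i) = ((k − 1) mod ((p−1)/ℓ),
(i − 1 + ((q−1)/ℓ)·⌊(k−1)·ℓ/(p−1)⌋) mod (q−1))` on
`{0,…,(p−1)/ℓ − 1} × {0,…,q−2} = ZMod ((p−1)/ℓ) × ZMod (q−1)` is a bijection with
exactly `gcd(q−1, (p+q−2)/ℓ)` orbits, each orbit having cardinality
`(p−1)(q−1)/gcd(ℓ(q−1), p+q−2)`.  (Here `·/·` on `ℤ` is floor division since the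
divisor `p−1` is positive, and reduction mod `n` is the cast into `ZMod n`.) -/
theorem loop_boundary_permutation_orbit_count
    (p q ℓ : ℕ) (hp : 2 ≤ p) (hq : 2 ≤ q) (hℓ : 1 ≤ ℓ)
    (hℓp : ℓ ∣ (p - 1)) (hℓq : ℓ ∣ (q - 1)) :
    Function.Bijective
      (fun x : ZMod ((p - 1) / ℓ) × ZMod (q - 1) =>
        ((x.1 - 1 : ZMod ((p - 1) / ℓ)),
         (x.2 - 1 + (((q - 1) / ℓ : ℕ) : ZMod (q - 1)) *
            (((((x.1.val : ℤ) - 1) * (ℓ : ℤ)) / ((p - 1 : ℕ) : ℤ) : ℤ) : ZMod (q - 1))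
          : ZMod (q - 1)))) ∧
    ∀ e : Equiv.Perm (ZMod ((p - 1) / ℓ) × ZMod (q - 1)),
      (∀ x : ZMod ((p - 1) / ℓ) × ZMod (q - 1),
        e x = ((x.1 - 1 : ZMod ((p - 1) / ℓ)),
          (x.2 - 1 + (((q - 1) / ℓ : ℕ) : ZMod (q - 1)) *
            (((((x.1.val : ℤ) - 1) * (ℓ : ℤ)) / ((p - 1 : ℕ) : ℤ) : ℤ) : ZMod (q - 1))
          : ZMod (q - 1)))) →
      Nat.card (MulAction.orbitRel.Quotient (Subgroup.zpowers e)
          (ZMod ((p - 1) / ℓ) × ZMod (q - 1)))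
        = Nat.gcd (q - 1) ((p + q - 2) / ℓ) ∧
      ∀ x : ZMod ((p - 1) / ℓ) × ZMod (q - 1),
        Nat.card (MulAction.orbit (Subgroup.zpowers e) x)
          = (p - 1) * (q - 1) / Nat.gcd (ℓ * (q - 1)) (p + q - 2) := by
  constructor
  · have : NeZero ((p - 1) / ℓ) :=
      ⟨(Nat.div_pos (Nat.le_of_dvd (by omega) hℓp) hℓ).ne'⟩
    have : NeZero (q - 1) := ⟨by omega⟩
    refine Finite.injective_iff_bijective.1 ?_
    rintro ⟨k, i⟩ ⟨k', i'⟩ h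
    simp only [Prod.mk.injEq, sub_left_inj] at h
    obtain ⟨rfl, h⟩ := h
    simpa using h
  · intro e he
    obtain ⟨a, ha⟩ := hℓp
    obtain ⟨b, hb⟩ := hℓq
    have hpa : (p - 1) / ℓ = a := Nat.div_eq_of_eq_mul_right hℓ ha
    have hqb : (q - 1) / ℓ = b := Nat.div_eq_of_eq_mul_right hℓ hb
    have hsum : p + q - 2 = ℓ * (a + b) := by rw [mul_add]; omega
    have hquot : (p + q - 2) / ℓ = a + b := Nat.div_eq_of_eq_mul_right hℓ hsum
    have hgcd : Nat.gcd (ℓ * (q - 1)) (p + q - 2) = ℓ * Nat.gcd (q - 1) (a + b) := by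
      rw [hsum, Nat.gcd_mul_left]
    have hfloor (k : ℤ) : k * (ℓ : ℤ) / ((p - 1 : ℕ) : ℤ) = k / (a : ℤ) := by
      rw [ha, mul_comm, Nat.cast_mul, Int.mul_ediv_mul_of_pos _ _ (by exact_mod_cast hℓ)]
    have : NeZero a := ⟨by rintro rfl; omega⟩
    have : NeZero (q - 1) := ⟨by omega⟩
    have hlength : (p - 1) * (q - 1) / Nat.gcd (ℓ * (q - 1)) (p + q - 2)
        = a * ((q - 1) / Nat.gcd (q - 1) (a + b)) := by
      rw [hgcd, ha, mul_assoc, Nat.mul_div_mul_left _ _ hℓ,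
        Nat.mul_div_assoc _ (Nat.gcd_dvd_left _ _)]
    rw [hquot, hlength]
    simp only [hfloor, hqb] at he
    subst hpa
    exact ⟨card_orbitRel_quotient_zpowers he, card_orbit_zpowers he⟩
end

section
/- Let p, q ≥ 2 be integers, d = gcd(p−1, q−1), let ℓ ≥ 1 divide d, and let m, n ∈ ℤ satisfy m·(p−1) + n·(q−1) = d. Set A = (p−1)(q−1)/d and work in the abelian group G = ZMod A × ZMod (d/ℓ); let α ∈ G be the image of the integer pair ((p−1)/d, −n) and β ∈ G the image of ((q−1)/d, m). Then for all integers k₊ with 0 ≤ k₊ < (p−1)/ℓ and i with 0 ≤ i ≤ q−2, setting k₋ = (−i) mod ((q−1)/ℓ) and j = (k₊ − ((p−1)/ℓ)·⌊(−i·ℓ)/(q−1)⌋) mod (p−1) (with ⌊·⌋ the integer floor and a mod n the representative in {0,…,n−1}), one has −j·β + k₋·α = −i·α − k₊·β in G. -/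
/-- Weight-compatibility at the node `q₃` for a loop polynomial.
With `d = gcd(p−1, q−1)`, `ℓ ∣ d`, Bézout coefficients `m(p−1) + n(q−1) = d`,
`A = (p−1)(q−1)/d`, `G = ZMod A × ZMod (d/ℓ)`, `α` the image of `((p−1)/d, −n)` and
`β` the image of `((q−1)/d, m)`: for `0 ≤ k₊ < (p−1)/ℓ` and `0 ≤ i ≤ q−2`, setting
`k₋ = (−i) mod ((q−1)/ℓ)` and `j = (k₊ − ((p−1)/ℓ)·⌊(−i·ℓ)/(q−1)⌋) mod (p−1)`,
one has `−j·β + k₋·α = −i·α − k₊·β` in `G`. -/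
theorem loop_weight_compatibility
    (p q d ℓ A : ℕ) (hp : 2 ≤ p) (hq : 2 ≤ q)
    (hd : d = Nat.gcd (p - 1) (q - 1)) (hℓ : 1 ≤ ℓ) (hℓd : ℓ ∣ d)
    (m n : ℤ) (hmn : m * ((p : ℤ) - 1) + n * ((q : ℤ) - 1) = (d : ℤ))
    (hA : A = (p - 1) * (q - 1) / d) :
    ∀ kp i : ℤ, 0 ≤ kp → kp < (((p - 1) / ℓ : ℕ) : ℤ) → 0 ≤ i → i ≤ (q : ℤ) - 2 →
    ∀ km j : ℤ,
      km = (-i) % (((q - 1) / ℓ : ℕ) : ℤ) →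
      j = (kp - (((p - 1) / ℓ : ℕ) : ℤ) * ((-i * (ℓ : ℤ)) / ((q - 1 : ℕ) : ℤ)))
            % ((p - 1 : ℕ) : ℤ) →
      (-j) • (((((q - 1) / d : ℕ) : ZMod A), ((m : ℤ) : ZMod (d / ℓ)))
          : ZMod A × ZMod (d / ℓ))
        + km • (((((p - 1) / d : ℕ) : ZMod A), ((-n : ℤ) : ZMod (d / ℓ)))
          : ZMod A × ZMod (d / ℓ))
      = (-i) • (((((p - 1) / d : ℕ) : ZMod A), ((-n : ℤ) : ZMod (d / ℓ)))
          : ZMod A × ZMod (d / ℓ))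
        - kp • (((((q - 1) / d : ℕ) : ZMod A), ((m : ℤ) : ZMod (d / ℓ)))
          : ZMod A × ZMod (d / ℓ)) := by
  intro kp i _ _ _ _ km j hkm hj
  obtain ⟨e, rfl⟩ := hℓd
  obtain ⟨a, ha⟩ : ℓ * e ∣ p - 1 := hd ▸ Nat.gcd_dvd_left _ _
  obtain ⟨b, hb⟩ : ℓ * e ∣ q - 1 := hd ▸ Nat.gcd_dvd_right _ _
  have hd0 : 0 < ℓ * e := hd ▸ Nat.gcd_pos_of_pos_left _ (by omega)
  have hA' : A = ℓ * e * a * b := by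
    rw [hA, ha, hb, mul_assoc (ℓ * e) a, Nat.mul_div_cancel_left _ hd0]
    ring
  have hP : (p - 1) / ℓ = e * a := by rw [ha, mul_assoc, Nat.mul_div_cancel_left _ hℓ]
  have hQ : (q - 1) / ℓ = e * b := by rw [hb, mul_assoc, Nat.mul_div_cancel_left _ hℓ]
  have hfloor : (-i * (ℓ : ℤ)) / ((q - 1 : ℕ) : ℤ) = (-i) / ((e * b : ℕ) : ℤ) := by
    rw [hb, mul_assoc, Nat.cast_mul ℓ, mul_comm (-i),
      Int.mul_ediv_mul_of_pos _ _ (by exact_mod_cast hℓ)]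
  rw [hP, hfloor, Int.emod_def, ha] at hj
  rw [hQ, Int.emod_def] at hkm
  generalize (-i) / ((e * b : ℕ) : ℤ) = f at hj hkm
  generalize (kp - ((e * a : ℕ) : ℤ) * f) / ((ℓ * e * a : ℕ) : ℤ) = t at hj
  have hPd : (p - 1) / (ℓ * e) = a := by rw [ha, Nat.mul_div_cancel_left _ hd0]
  have hQd : (q - 1) / (ℓ * e) = b := by rw [hb, Nat.mul_div_cancel_left _ hd0]
  rw [hPd, hQd, Nat.mul_div_cancel_left _ hℓ, hkm, hj]
  have hA0 : (ℓ * e * a * b : ZMod A) = 0 := by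
    have h : ((ℓ * e * a * b : ℕ) : ZMod A) = 0 := (ZMod.natCast_eq_zero_iff _ _).2 hA'.dvd
    exact_mod_cast h
  have he0 : (e : ZMod e) = 0 := ZMod.natCast_self e
  ext
  · simp only [Prod.fst_add, Prod.fst_sub, Prod.smul_mk, zsmul_eq_mul]
    push_cast
    linear_combination (t : ZMod A) * hA0
  · simp only [Prod.snd_add, Prod.snd_sub, Prod.smul_mk, zsmul_eq_mul]
    push_cast
    linear_combination ((a * f * m + ℓ * a * t * m + b * f * n : ZMod e)) * he0
end

section
/- Let p, q ≥ 2 be integers, d = gcd(p−1, q−1), let ℓ ≥ 1 divide d, and let m, n ∈ ℤ satisfy m·(p−1) + n·(q−1) = d; set A = (p−1)(q−1)/d. There are well-defined additive group homomorphisms φ : ZMod((p−1)/ℓ) → ZMod A × ZMod(d/ℓ) sending the class of an integer c to the class of the pair (−c·n·ℓ·(q−1)/d, −c), and ψ : ZMod A × ZMod(d/ℓ) → ZMod(q−1) sending the class of an integer pair (a, b) to the class of a − (n·ℓ·(q−1)/d)·b. Moreover φ is injective, ψ is surjective, and the range of φ equals the kernel of ψ; that is, 0 → ZMod((p−1)/ℓ)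 → ZMod A × ZMod(d/ℓ) → ZMod(q−1) → 0 is a short exact sequence. -/
theorem ZMod.exists_addMonoidHom_intCast {B : Type*} [AddCommGroup B] (N : ℕ) (x : B)
    (hx : (N : ℤ) • x = 0) : ∃ f : ZMod N →+ B, ∀ c : ℤ, f (c : ZMod N) = c • x :=
  ⟨ZMod.lift N ⟨zmultiplesHom B x, by simpa using hx⟩, fun c => by simp⟩

theorem loop_gerbe_exact_of_coprime_factors (e ℓ P Q : ℕ) (he : 0 < e) (hℓ : 0 < ℓ)
    (hQ : 0 < Q) (m n : ℤ) (hmn : m * P + n * Q = 1) :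
    ∃ φ : ZMod (e * P) →+ ZMod (ℓ * e * P * Q) × ZMod e,
    ∃ ψ : ZMod (ℓ * e * P * Q) × ZMod e →+ ZMod (ℓ * e * Q),
      (∀ c : ℤ, φ (c : ZMod (e * P)) =
        (((-c * n * (ℓ : ℤ) * (Q : ℤ) : ℤ) : ZMod (ℓ * e * P * Q)), ((-c : ℤ) : ZMod e))) ∧
      (∀ a b : ℤ, ψ ((a : ZMod (ℓ * e * P * Q)), (b : ZMod e)) =
        ((a - (n * (ℓ : ℤ) * (Q : ℤ)) * b : ℤ) : ZMod (ℓ * e * Q))) ∧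
      Function.Injective φ ∧ Function.Surjective ψ ∧ φ.range = ψ.ker := by
  obtain ⟨φ, hφ⟩ := ZMod.exists_addMonoidHom_intCast (e * P)
    ((((-n * ℓ * Q : ℤ) : ZMod (ℓ * e * P * Q)), ((-1 : ℤ) : ZMod e))) (by
      rw [Prod.smul_mk, Prod.mk_eq_zero, zsmul_eq_mul, zsmul_eq_mul, ← Int.cast_mul,
        ← Int.cast_mul, ZMod.intCast_zmod_eq_zero_iff_dvd, ZMod.intCast_zmod_eq_zero_iff_dvd]
      push_cast
      exact ⟨⟨-n, by ring⟩, ⟨-P, by ring⟩⟩)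
  obtain ⟨α, hα⟩ := ZMod.exists_addMonoidHom_intCast (ℓ * e * P * Q)
    ((1 : ℤ) : ZMod (ℓ * e * Q)) (by
      rw [zsmul_eq_mul, ← Int.cast_mul, ZMod.intCast_zmod_eq_zero_iff_dvd]
      push_cast
      exact ⟨P, by ring⟩)
  obtain ⟨β, hβ⟩ := ZMod.exists_addMonoidHom_intCast e
    ((-n * ℓ * Q : ℤ) : ZMod (ℓ * e * Q)) (by
      rw [zsmul_eq_mul, ← Int.cast_mul, ZMod.intCast_zmod_eq_zero_iff_dvd]
      push_cast
      exact ⟨-n, by ring⟩)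
  have hφ' : ∀ c : ℤ, φ (c : ZMod (e * P)) =
      (((-c * n * (ℓ : ℤ) * (Q : ℤ) : ℤ) : ZMod (ℓ * e * P * Q)), ((-c : ℤ) : ZMod e)) := by
    intro c
    rw [hφ, Prod.smul_mk, zsmul_eq_mul, zsmul_eq_mul, ← Int.cast_mul, ← Int.cast_mul]
    congr 2 <;> ring
  have hψ : ∀ a b : ℤ, α.coprod β ((a : ZMod (ℓ * e * P * Q)), (b : ZMod e)) =
      ((a - (n * (ℓ : ℤ) * (Q : ℤ)) * b : ℤ) : ZMod (ℓ * e * Q)) := by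
    intro a b
    rw [AddMonoidHom.coprod_apply, hα, hβ, zsmul_eq_mul, zsmul_eq_mul, ← Int.cast_mul,
      ← Int.cast_mul, ← Int.cast_add]
    congr 1; ring
  refine ⟨φ, α.coprod β, hφ', hψ, ?_, ?_, ?_⟩
  · rw [injective_iff_map_eq_zero]
    intro x hx
    obtain ⟨c, rfl⟩ := ZMod.intCast_surjective x
    rw [hφ', Prod.mk_eq_zero, ZMod.intCast_zmod_eq_zero_iff_dvd,
      ZMod.intCast_zmod_eq_zero_iff_dvd, Int.dvd_neg] at hx
    obtain ⟨⟨t, ht⟩, k, rfl⟩ := hx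
    rw [ZMod.intCast_zmod_eq_zero_iff_dvd]
    push_cast at ht ⊢
    have hne : (ℓ * e * Q : ℤ) ≠ 0 := by positivity
    have hk : k * n = -(P * t) := by
      apply mul_left_cancel₀ hne
      linear_combination -ht
    exact mul_dvd_mul_left _ ⟨k * m - Q * t, by linear_combination -k * hmn + Q * hk⟩
  · intro y
    obtain ⟨a, rfl⟩ := ZMod.intCast_surjective y
    exact ⟨((a : ZMod _), ((0 : ℤ) : ZMod _)), by rw [hψ]; simp⟩
  · ext ⟨x, y⟩
    rw [AddMonoidHom.mem_range, AddMonoidHom.mem_ker]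
    constructor
    · rintro ⟨z, hz⟩
      obtain ⟨c, rfl⟩ := ZMod.intCast_surjective z
      rw [← hz, hφ', hψ, ZMod.intCast_zmod_eq_zero_iff_dvd]
      exact ⟨0, by ring⟩
    · intro h
      obtain ⟨a, rfl⟩ := ZMod.intCast_surjective x
      obtain ⟨b, rfl⟩ := ZMod.intCast_surjective y
      rw [hψ, ZMod.intCast_zmod_eq_zero_iff_dvd] at h
      obtain ⟨t, ht⟩ := h
      push_cast at ht
      refine ⟨((-b - e * Q * t : ℤ) : ZMod (e * P)), ?_⟩
      rw [hφ', Prod.mk.injEq, ZMod.intCast_eq_intCast_iff_dvd_sub,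
        ZMod.intCast_eq_intCast_iff_dvd_sub]
      push_cast
      exact ⟨⟨t * m, by linear_combination ht - ℓ * e * Q * t * hmn⟩, ⟨-(Q * t), by ring⟩⟩


/-- The additive short exact sequence
`0 → ZMod((p−1)/ℓ) → ZMod A × ZMod(d/ℓ) → ZMod(q−1) → 0`, where `d = gcd(p−1, q−1)`,
`ℓ ∣ d`, `m(p−1) + n(q−1) = d`, `A = (p−1)(q−1)/d`, the first map sends the class of
`c` to the class of `(−c·n·ℓ·(q−1)/d, −c)` and the second sends the class of `(a, b)`
to the class of `a − (n·ℓ·(q−1)/d)·b`. -/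
theorem loop_gerbe_short_exact_sequence
    (p q d ℓ A : ℕ) (hp : 2 ≤ p) (hq : 2 ≤ q)
    (hd : d = Nat.gcd (p - 1) (q - 1)) (hℓ : 1 ≤ ℓ) (hℓd : ℓ ∣ d)
    (m n : ℤ) (hmn : m * ((p : ℤ) - 1) + n * ((q : ℤ) - 1) = (d : ℤ))
    (hA : A = (p - 1) * (q - 1) / d) :
    ∃ φ : ZMod ((p - 1) / ℓ) →+ ZMod A × ZMod (d / ℓ),
    ∃ ψ : ZMod A × ZMod (d / ℓ) →+ ZMod (q - 1),
      (∀ c : ℤ, φ ((c : ZMod ((p - 1) / ℓ))) =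
        (((-c * n * (ℓ : ℤ) * (((q - 1) / d : ℕ) : ℤ) : ℤ) : ZMod A),
         ((-c : ℤ) : ZMod (d / ℓ)))) ∧
      (∀ a b : ℤ, ψ (((a : ZMod A)), ((b : ZMod (d / ℓ)))) =
        ((a - (n * (ℓ : ℤ) * (((q - 1) / d : ℕ) : ℤ)) * b : ℤ) : ZMod (q - 1))) ∧
      Function.Injective φ ∧ Function.Surjective ψ ∧
      φ.range = ψ.ker := by
  have hd0 : 0 < d := hd ▸ Nat.gcd_pos_of_pos_left _ (by omega)
  obtain ⟨P, hP⟩ : d ∣ p - 1 := hd ▸ Nat.gcd_dvd_left _ _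
  obtain ⟨Q, hQ⟩ : d ∣ q - 1 := hd ▸ Nat.gcd_dvd_right _ _
  obtain ⟨e, rfl⟩ := hℓd
  have he : 0 < e := Nat.pos_of_mul_pos_left hd0
  have hQ0 : 0 < Q := Nat.pos_of_ne_zero (by rintro rfl; omega)
  have hA' : A = ℓ * e * P * Q := by
    rw [hA, hP, hQ]
    exact Nat.div_eq_of_eq_mul_right hd0 (by ring)
  have hpℓ : (p - 1) / ℓ = e * P := Nat.div_eq_of_eq_mul_right hℓ (by rw [hP]; ring)
  have hqd : (q - 1) / (ℓ * e) = Q := Nat.div_eq_of_eq_mul_right hd0 hQ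
  have hdℓ : ℓ * e / ℓ = e := Nat.mul_div_cancel_left e hℓ
  have hbez : m * P + n * Q = 1 := by
    have hp' : (p : ℤ) - 1 = ℓ * e * P := by
      rw [← Nat.cast_pred (by omega), hP]; push_cast; ring
    have hq' : (q : ℤ) - 1 = ℓ * e * Q := by
      rw [← Nat.cast_pred (by omega), hQ]; push_cast; ring
    have hne : (ℓ * e : ℤ) ≠ 0 := by exact_mod_cast hd0.ne'
    rw [hp', hq'] at hmn
    push_cast at hmn
    apply mul_left_cancel₀ hne
    linear_combination hmn
  rw [hpℓ, hqd, hdℓ, hA', hQ]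
  exact loop_gerbe_exact_of_coprime_factors e ℓ P Q he hℓ hQ0 m n hbez
end

section
/- Let p, q ≥ 2 be integers and let ℓ ≥ 1 divide both p−1 and q−1; set M = (p−1)(q−1)/ℓ. Each element of {0,…,M−1} is uniquely of the form k₊(q−1)+i with 0 ≤ k₊ < (p−1)/ℓ and 0 ≤ i < q−1, and uniquely of the form k₋(p−1)+a with 0 ≤ k₋ < (q−1)/ℓ and 0 ≤ a < p−1. Define maps on {0,…,M−1}: σ₃(k₊(q−1)+i) = k₋(p−1) + ((−j) mod (p−1)), where k₋ = (−i) mod ((q−1)/ℓ) and j = (k₊ − ((p−1)/ℓ)·⌊(−i·ℓ)/(q−1)⌋) mod (p−1); τ_r(k₊(q−1)+i) = k₊(q−1) + ((i−1) mod (q−1)); τ_ℓ(k₋(p−1)+a) = k₋(p−1) + ((a+1) mod (p−1)); and g(k₊(q−1)+i) = (q−1)·((k₊−1) mod ((p−1)/ℓ)) + ((i − 1 + ((q−1)/ℓ)·⌊(k₊−1)·ℓ/(p−1)⌋) mod (q−1)). Then σ₃ is a bijection and τ_ℓ ∘ σ₃ ∘ τ_r = σ₃ ∘ g. -/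
/-- The gluing permutation `σ₃` on `{0,…,(p−1)(q−1)/ℓ − 1}`, sending
`k₊(q−1)+i ↦ k₋(p−1) + ((−j) mod (p−1))` where `k₋ = (−i) mod ((q−1)/ℓ)` and
`j = (k₊ − ((p−1)/ℓ)·⌊(−i·ℓ)/(q−1)⌋) mod (p−1)`.  Integer division `·/·` on `ℤ`
is floor division for positive divisors, and `· % n` gives the representative in
`{0,…,n−1}`. -/
def loopSigmaThree (p q ℓ c : ℕ) : ℕ :=
  let kp : ℤ := ((c / (q - 1) : ℕ) : ℤ)
  let i : ℤ := ((c % (q - 1) : ℕ) : ℤ)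
  let km : ℤ := (-i) % (((q - 1) / ℓ : ℕ) : ℤ)
  let j : ℤ := (kp - (((p - 1) / ℓ : ℕ) : ℤ) * ((-i * (ℓ : ℤ)) / ((q - 1 : ℕ) : ℤ)))
      % ((p - 1 : ℕ) : ℤ)
  (km * ((p - 1 : ℕ) : ℤ) + (-j) % ((p - 1 : ℕ) : ℤ)).toNat

/-- The blockwise rotation `τ_r(k₊(q−1)+i) = k₊(q−1) + ((i−1) mod (q−1))`. -/
def loopTauR (q c : ℕ) : ℕ :=
  (c / (q - 1)) * (q - 1) + ((((c % (q - 1) : ℕ) : ℤ) - 1) % ((q - 1 : ℕ) : ℤ)).toNat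

/-- The blockwise rotation `τ_ℓ(k₋(p−1)+a) = k₋(p−1) + ((a+1) mod (p−1))`. -/
def loopTauL (p c : ℕ) : ℕ :=
  (c / (p - 1)) * (p - 1) + (c % (p - 1) + 1) % (p - 1)

/-- The map `g(k₊(q−1)+i) = (q−1)·((k₊−1) mod ((p−1)/ℓ))
+ ((i − 1 + ((q−1)/ℓ)·⌊(k₊−1)·ℓ/(p−1)⌋) mod (q−1))`. -/
def loopG (p q ℓ c : ℕ) : ℕ :=
  (q - 1) * (((((c / (q - 1) : ℕ) : ℤ) - 1) % (((p - 1) / ℓ : ℕ) : ℤ)).toNat)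
    + ((((c % (q - 1) : ℕ) : ℤ) - 1
        + (((q - 1) / ℓ : ℕ) : ℤ)
          * (((((c / (q - 1) : ℕ) : ℤ) - 1) * (ℓ : ℤ)) / ((p - 1 : ℕ) : ℤ)))
      % ((q - 1 : ℕ) : ℤ)).toNat

/-- Block decomposition of the elements of an initial segment of `ℕ`. -/
theorem existsUnique_block_decomposition {n b c : ℕ} (hb : 0 < b) (hc : c < n * b) :
    ∃! x : ℕ × ℕ, x.1 < n ∧ x.2 < b ∧ c = x.1 * b + x.2 := by
  refine ⟨(c / b, c % b), ⟨(Nat.div_lt_iff_lt_mul hb).2 hc, Nat.mod_lt _ hb,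
    (Nat.div_add_mod' c b).symm⟩, ?_⟩
  rintro ⟨k, i⟩ ⟨-, hi, rfl⟩
  have hi' : i < b := hi
  simp [Nat.mul_add_div hb, mul_comm k b, Nat.div_eq_of_lt hi',
    Nat.mod_eq_of_lt hi']

theorem block_div (k b : ℕ) (hb : 0 < b) (i : ℤ) : (k * b + (i % (b : ℤ)).toNat) / b = k := by
  have h1 := Int.emod_nonneg i (b := (b : ℤ)) (by omega)
  have h2 := Int.emod_lt_of_pos i (b := (b : ℤ)) (by omega)
  have h3 : (i % (b : ℤ)).toNat < b := by omega
  rw [mul_comm, Nat.mul_add_div hb, Nat.div_eq_of_lt h3, add_zero]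

theorem block_mod (k b : ℕ) (hb : 0 < b) (i : ℤ) :
    (((k * b + (i % (b : ℤ)).toNat) % b : ℕ) : ℤ) = i % (b : ℤ) := by
  have h1 := Int.emod_nonneg i (b := (b : ℤ)) (by omega)
  have h2 := Int.emod_lt_of_pos i (b := (b : ℤ)) (by omega)
  have h3 : (i % (b : ℤ)).toNat < b := by omega
  rw [mul_comm, Nat.mul_add_mod, Nat.mod_eq_of_lt h3, Int.toNat_of_nonneg h1]

/-- `σ₃` in block coordinates, with the second coordinate an arbitrary integer representative. -/
theorem loopSigmaThree_block {P Q ℓ : ℕ} (hP : 0 < P) (hQ : 0 < Q) (hℓ : 0 < ℓ) (k : ℕ)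
    (i : ℤ) :
    loopSigmaThree (ℓ * P + 1) (ℓ * Q + 1) ℓ (k * (ℓ * Q) + (i % ((ℓ * Q : ℕ) : ℤ)).toNat) =
      ((-i) % (Q : ℤ)).toNat * (ℓ * P)
        + (((P : ℤ) * ((-i) / (Q : ℤ)) - k) % ((ℓ * P : ℕ) : ℤ)).toNat := by
  have hQ' : (Q : ℤ) ≠ 0 := by omega
  have hB : 0 < ℓ * Q := Nat.mul_pos hℓ hQ
  unfold loopSigmaThree
  simp only [Nat.add_sub_cancel, Nat.mul_div_cancel_left _ hℓ]
  rw [block_div _ _ hB, block_mod _ _ hB]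
  have hr : -(i % ((ℓ * Q : ℕ) : ℤ)) = -i + (Q : ℤ) * (ℓ * (i / ((ℓ * Q : ℕ) : ℤ))) := by
    rw [Int.emod_def]; push_cast; ring
  generalize i / ((ℓ * Q : ℕ) : ℤ) = e at hr
  rw [hr, Int.add_mul_emod_self_left]
  have hd : (-i + (Q : ℤ) * (ℓ * e)) * (ℓ : ℤ) / ((ℓ * Q : ℕ) : ℤ) = (-i) / (Q : ℤ) + ℓ * e := by
    rw [Nat.cast_mul, mul_comm _ (ℓ : ℤ), Int.mul_ediv_mul_of_pos _ _ (by omega),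
      Int.add_mul_ediv_left _ _ hQ']
  rw [hd]
  have hj : (-(((k : ℤ) - P * ((-i) / (Q : ℤ) + ℓ * e)) % ((ℓ * P : ℕ) : ℤ))) % ((ℓ * P : ℕ) : ℤ)
      = ((P : ℤ) * ((-i) / (Q : ℤ)) - k) % ((ℓ * P : ℕ) : ℤ) := by
    exact (Int.mod_modEq _ _).neg.trans (Int.modEq_iff_dvd.2 ⟨-e, by push_cast; ring⟩)
  rw [hj]
  have h1 := Int.emod_nonneg (-i) hQ'
  have h2 := Int.emod_nonneg ((P : ℤ) * ((-i) / (Q : ℤ)) - k) (b := ((ℓ * P : ℕ) : ℤ))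
    (by have := Nat.mul_pos hℓ hP; omega)
  rw [Int.toNat_add (mul_nonneg h1 (Nat.cast_nonneg _)) h2, Int.toNat_mul h1 (Nat.cast_nonneg _),
    Int.toNat_natCast]

theorem loopTauL_block (b k : ℕ) (hb : 0 < b) (a : ℤ) :
    loopTauL (b + 1) (k * b + (a % (b : ℤ)).toNat) = k * b + ((a + 1) % (b : ℤ)).toNat := by
  unfold loopTauL
  rw [Nat.add_sub_cancel, block_div _ _ hb]
  congr 1
  apply Int.natCast_inj.1
  rw [Int.toNat_of_nonneg (Int.emod_nonneg _ (by omega)), Int.natCast_mod, Nat.cast_add,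
    block_mod _ _ hb]
  simp

/-- `σ₃` maps its domain to itself. -/
theorem loopSigmaThree_lt {P Q ℓ c : ℕ} (hP : 0 < P) (hQ : 0 < Q) (hℓ : 0 < ℓ) :
    loopSigmaThree (ℓ * P + 1) (ℓ * Q + 1) ℓ c < Q * (ℓ * P) := by
  have hA : 0 < ℓ * P := Nat.mul_pos hℓ hP
  have hc := loopSigmaThree_block hP hQ hℓ (c / (ℓ * Q)) (c % (ℓ * Q) : ℕ)
  rw [← Int.natCast_mod, Int.toNat_natCast, Nat.mod_mod, Nat.div_add_mod'] at hc
  rw [hc]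
  have h1 := Int.emod_nonneg (-((c % (ℓ * Q) : ℕ) : ℤ)) (b := (Q : ℤ)) (by omega)
  have h2 := Int.emod_lt_of_pos (-((c % (ℓ * Q) : ℕ) : ℤ)) (b := (Q : ℤ)) (by omega)
  have h3 := Int.emod_lt_of_pos ((P : ℤ) * ((-((c % (ℓ * Q) : ℕ) : ℤ)) / (Q : ℤ))
    - (c / (ℓ * Q) : ℕ)) (b := ((ℓ * P : ℕ) : ℤ)) (by omega)
  generalize hx : ((-((c % (ℓ * Q) : ℕ) : ℤ)) % (Q : ℤ)).toNat = x
  have hx' : x + 1 ≤ Q := by omega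
  calc _ < (x + 1) * (ℓ * P) := by rw [add_mul, one_mul]; omega
    _ ≤ _ := Nat.mul_le_mul_right _ hx'

theorem loopSigmaThree_injOn {P Q ℓ : ℕ} (hP : 0 < P) (hQ : 0 < Q) (hℓ : 0 < ℓ) :
    Set.InjOn (loopSigmaThree (ℓ * P + 1) (ℓ * Q + 1) ℓ) (Set.Iio (P * (ℓ * Q))) := by
  have hA : 0 < ℓ * P := Nat.mul_pos hℓ hP
  have hB : 0 < ℓ * Q := Nat.mul_pos hℓ hQ
  intro c hc d hd h
  have hk := (Nat.div_lt_iff_lt_mul hB).2 hc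
  have hm := (Nat.div_lt_iff_lt_mul hB).2 hd
  have hcb := loopSigmaThree_block hP hQ hℓ (c / (ℓ * Q)) (c % (ℓ * Q) : ℕ)
  have hdb := loopSigmaThree_block hP hQ hℓ (d / (ℓ * Q)) (d % (ℓ * Q) : ℕ)
  rw [← Int.natCast_mod, Int.toNat_natCast, Nat.mod_mod, Nat.div_add_mod'] at hcb hdb
  rw [hcb, hdb] at h
  rw [← Nat.div_add_mod' c (ℓ * Q), ← Nat.div_add_mod' d (ℓ * Q)]
  have hi := Nat.mod_lt c hB
  have hj := Nat.mod_lt d hB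
  generalize c / (ℓ * Q) = k at *
  generalize d / (ℓ * Q) = m at *
  generalize c % (ℓ * Q) = i at *
  generalize d % (ℓ * Q) = j at *
  clear hcb hdb hc hd
  have hdiv := congrArg (· / (ℓ * P)) h
  have hmod := congrArg (fun x : ℕ => ((x % (ℓ * P) : ℕ) : ℤ)) h
  simp only [block_div _ _ hA, block_mod _ _ hA] at hdiv hmod
  have h1 := Int.emod_nonneg (-(i : ℤ)) (b := (Q : ℤ)) (by omega)
  have h2 := Int.emod_nonneg (-(j : ℤ)) (b := (Q : ℤ)) (by omega)
  have hr : (-(i : ℤ)) % (Q : ℤ) = (-(j : ℤ)) % (Q : ℤ) := by omega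
  have hi' := Int.emod_add_mul_ediv (-(i : ℤ)) Q
  have hj' := Int.emod_add_mul_ediv (-(j : ℤ)) Q
  generalize (-(i : ℤ)) / (Q : ℤ) = s at *
  generalize (-(j : ℤ)) / (Q : ℤ) = t at *
  obtain ⟨e, he⟩ := Int.ModEq.dvd hmod
  push_cast at he
  have hkm : k = m := by
    have : (k : ℤ) ≡ m [ZMOD P] :=
      (Int.modEq_iff_dvd.2 ⟨t - s - ℓ * e, by linear_combination -he⟩)
    exact Nat.ModEq.eq_of_lt_of_lt (Int.natCast_modEq_iff.1 this) hk hm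
  subst hkm
  have hst : t - s = ℓ * e := by
    have hP' : (P : ℤ) ≠ 0 := by omega
    apply mul_left_cancel₀ hP'
    linear_combination he
  have hij : (i : ℤ) ≡ j [ZMOD ((ℓ * Q : ℕ) : ℤ)] :=
    Int.modEq_iff_dvd.2 ⟨-e, by
      push_cast
      linear_combination hj' - hi' + hr - (Q : ℤ) * hst⟩
  rw [Nat.ModEq.eq_of_lt_of_lt (Int.natCast_modEq_iff.1 hij) hi hj]

theorem loopTauL_sigmaThree_tauR {P Q ℓ : ℕ} (hP : 0 < P) (hQ : 0 < Q) (hℓ : 0 < ℓ) (c : ℕ) :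
    loopTauL (ℓ * P + 1) (loopSigmaThree (ℓ * P + 1) (ℓ * Q + 1) ℓ (loopTauR (ℓ * Q + 1) c))
      = loopSigmaThree (ℓ * P + 1) (ℓ * Q + 1) ℓ (loopG (ℓ * P + 1) (ℓ * Q + 1) ℓ c) := by
  have hA : 0 < ℓ * P := Nat.mul_pos hℓ hP
  unfold loopTauR loopG
  simp only [Nat.add_sub_cancel, Nat.mul_div_cancel_left _ hℓ]
  rw [loopSigmaThree_block hP hQ hℓ, loopTauL_block _ _ hA, mul_comm (ℓ * Q) (Int.toNat _),
    loopSigmaThree_block hP hQ hℓ]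
  generalize c / (ℓ * Q) = k
  generalize c % (ℓ * Q) = i
  have ht : ((k : ℤ) - 1) * (ℓ : ℤ) / ((ℓ * P : ℕ) : ℤ) = ((k : ℤ) - 1) / P := by
    rw [Nat.cast_mul, mul_comm _ (ℓ : ℤ), Int.mul_ediv_mul_of_pos _ _ (by omega)]
  have hk := Int.emod_add_mul_ediv ((k : ℤ) - 1) P
  rw [ht, Int.toNat_of_nonneg (Int.emod_nonneg ((k : ℤ) - 1) (by omega))]
  generalize ((k : ℤ) - 1) / P = t at *
  have hn : -((i : ℤ) - 1 + Q * t) = -((i : ℤ) - 1) + Q * (-t) := by ring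
  rw [hn, Int.add_mul_emod_self_left, Int.add_mul_ediv_left _ _ (by omega)]
  congr 3
  linear_combination hk

/-- For `p, q ≥ 2` and `ℓ` dividing `p−1` and `q−1`, with
`M = (p−1)(q−1)/ℓ`: every element of `{0,…,M−1}` is uniquely of the form
`k₊(q−1)+i` with `k₊ < (p−1)/ℓ`, `i < q−1`, and uniquely of the form `k₋(p−1)+a`
with `k₋ < (q−1)/ℓ`, `a < p−1`; the map `σ₃` is a bijection of `{0,…,M−1}`, and
`τ_ℓ ∘ σ₃ ∘ τ_r = σ₃ ∘ g` on `{0,…,M−1}`. -/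
theorem loop_gluing_permutation_identity
    (p q ℓ M : ℕ) (hp : 2 ≤ p) (hq : 2 ≤ q) (hℓ : 1 ≤ ℓ)
    (hℓp : ℓ ∣ (p - 1)) (hℓq : ℓ ∣ (q - 1)) (hM : M = (p - 1) * (q - 1) / ℓ) :
    (∀ c < M, ∃! ki : ℕ × ℕ,
      ki.1 < (p - 1) / ℓ ∧ ki.2 < q - 1 ∧ c = ki.1 * (q - 1) + ki.2) ∧
    (∀ c < M, ∃! ka : ℕ × ℕ,
      ka.1 < (q - 1) / ℓ ∧ ka.2 < p - 1 ∧ c = ka.1 * (p - 1) + ka.2) ∧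
    Set.BijOn (loopSigmaThree p q ℓ) (Set.Iio M) (Set.Iio M) ∧
    ∀ c < M, loopTauL p (loopSigmaThree p q ℓ (loopTauR q c))
      = loopSigmaThree p q ℓ (loopG p q ℓ c) := by
  obtain ⟨P, hP⟩ := hℓp
  obtain ⟨Q, hQ⟩ := hℓq
  obtain rfl : p = ℓ * P + 1 := by omega
  obtain rfl : q = ℓ * Q + 1 := by omega
  have hA : 0 < ℓ * P := by omega
  have hB : 0 < ℓ * Q := by omega
  have hP0 : 0 < P := Nat.pos_of_mul_pos_left hA
  have hQ0 : 0 < Q := Nat.pos_of_mul_pos_left hB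
  simp only [Nat.add_sub_cancel, Nat.mul_div_cancel_left _ hℓ] at hM ⊢
  have hM₁ : M = P * (ℓ * Q) := by
    rw [hM, mul_assoc, Nat.mul_div_cancel_left _ hℓ]
  have hM₂ : M = Q * (ℓ * P) := by rw [hM₁]; ring
  refine ⟨fun c hc => existsUnique_block_decomposition hB (hM₁ ▸ hc),
    fun c hc => existsUnique_block_decomposition hA (hM₂ ▸ hc), ?_,
    fun c _ => loopTauL_sigmaThree_tauR hP0 hQ0 hℓ c⟩
  have hmaps : Set.MapsTo (loopSigmaThree (ℓ * P + 1) (ℓ * Q + 1) ℓ) (Set.Iio M) (Set.Iio M) :=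
    fun c _ => hM₂ ▸ loopSigmaThree_lt hP0 hQ0 hℓ
  have hinj : Set.InjOn (loopSigmaThree (ℓ * P + 1) (ℓ * Q + 1) ℓ) (Set.Iio M) :=
    hM₁ ▸ loopSigmaThree_injOn hP0 hQ0 hℓ
  refine ⟨hmaps, hinj, ?_⟩
  have := Finset.surjOn_of_injOn_of_card_le (s := Finset.Iio M) (t := Finset.Iio M) _
    (by simpa using hmaps) (by simpa using hinj) le_rfl
  simpa using this
end

section
/- Let p, q ≥ 2 be integers and let ℓ ≥ 1 divide both p and q−1; set N = (p−1)(q−1)/ℓ. Each element of {0,…,N−1} is uniquely of the form k(p−1)+a with 0 ≤ k < (q−1)/ℓ and 0 ≤ a < p−1. Define maps on {0,…,N−1}: σ₂(c) = k₋(p−1) + ((−j) mod (p−1)), where k₋ = (−c) mod ((q−1)/ℓ) and j = (−(p/ℓ)·⌊(−c·ℓ)/(q−1)⌋) mod (p−1); τ_r(c) = (c−1) mod N; and τ_ℓ(k(p−1)+a) = k(p−1) + ((a+1) mod (p−1)). Then σ₂ is a bijection and τ_ℓ ∘ σ₂ ∘ τ_r = σ₂ ∘ t, where t(c) = (c − q)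 mod N. -/
/-- The gluing permutation `σ₂` on `{0,…,(p−1)(q−1)/ℓ − 1}`, sending
`c ↦ k₋(p−1) + ((−j) mod (p−1))` where `k₋ = (−c) mod ((q−1)/ℓ)` and
`j = (−(p/ℓ)·⌊(−c·ℓ)/(q−1)⌋) mod (p−1)`.  Integer division `·/·` on `ℤ` is floor
division for positive divisors, and `· % n` gives the representative in `{0,…,n−1}`. -/
def chainSigmaTwo (p q ℓ c : ℕ) : ℕ :=
  let km : ℤ := (-(c : ℤ)) % (((q - 1) / ℓ : ℕ) : ℤ)
  let j : ℤ := (-((p / ℓ : ℕ) : ℤ) * ((-(c : ℤ) * (ℓ : ℤ)) / ((q - 1 : ℕ) : ℤ)))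
      % ((p - 1 : ℕ) : ℤ)
  (km * ((p - 1 : ℕ) : ℤ) + (-j) % ((p - 1 : ℕ) : ℤ)).toNat

/-- The global rotation `τ_r(c) = (c−1) mod N`. -/
def chainTauR (N c : ℕ) : ℕ := (((c : ℤ) - 1) % (N : ℤ)).toNat

/-- The blockwise rotation `τ_ℓ(k(p−1)+a) = k(p−1) + ((a+1) mod (p−1))`. -/
def chainTauL (p c : ℕ) : ℕ :=
  (c / (p - 1)) * (p - 1) + (c % (p - 1) + 1) % (p - 1)

/-- The translation `t(c) = (c − q) mod N`. -/
def chainT (q N c : ℕ) : ℕ := (((c : ℤ) - (q : ℤ)) % (N : ℤ)).toNat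

/-- The gluing permutation read on `ℤ`: the mixed-radix digits `(x % m, x / m)` of `x` are sent to
the block number `x % m` and the position `P * (x / m) % M` inside the block of length `M`. -/
def gluingInt (M m P x : ℤ) : ℤ := (x % m) * M + P * (x / m) % M

theorem gluingInt_add_mul {m : ℤ} (hm : 0 < m) (M P x k : ℤ) :
    gluingInt M m P (x + k * m) = (x % m) * M + (P * (x / m) + P * k) % M := by
  unfold gluingInt
  rw [Int.add_mul_emod_self_right, Int.add_mul_ediv_right _ _ hm.ne', mul_add]

theorem gluingInt_congr {M m : ℤ} (hm : 0 < m) (P : ℤ) {x y : ℤ}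
    (h : x ≡ y [ZMOD M * m]) : gluingInt M m P x = gluingInt M m P y := by
  obtain ⟨k, hk⟩ := h.dvd
  obtain rfl : y = x + (k * M) * m := by linear_combination hk
  rw [gluingInt_add_mul hm, ← mul_assoc, Int.add_mul_emod_self_right]
  rfl

theorem gluingInt_nonneg {M m : ℤ} (hM : 0 < M) (hm : 0 < m) (P x : ℤ) :
    0 ≤ gluingInt M m P x :=
  add_nonneg (mul_nonneg (Int.emod_nonneg _ hm.ne') hM.le) (Int.emod_nonneg _ hM.ne')

theorem gluingInt_lt {M m : ℤ} (hM : 0 < M) (hm : 0 < m) (P x : ℤ) :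
    gluingInt M m P x < M * m := by
  unfold gluingInt
  nlinarith [Int.emod_lt_of_pos x hm, Int.emod_lt_of_pos (P * (x / m)) hM]

theorem gluingInt_ediv {M : ℤ} (hM : 0 < M) (m P x : ℤ) :
    gluingInt M m P x / M = x % m := by
  unfold gluingInt
  rw [add_comm, Int.add_mul_ediv_right _ _ hM.ne',
    Int.ediv_eq_zero_of_lt (Int.emod_nonneg _ hM.ne') (Int.emod_lt_of_pos _ hM), zero_add]

theorem gluingInt_emod (M m P x : ℤ) : gluingInt M m P x % M = P * (x / m) % M := by
  unfold gluingInt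
  rw [add_comm, Int.add_mul_emod_self_right, Int.emod_emod]

theorem modEq_of_gluingInt_eq {M m P : ℤ} (hM : 0 < M) (hP : IsCoprime M P) {x y : ℤ}
    (h : gluingInt M m P x = gluingInt M m P y) : x ≡ y [ZMOD M * m] := by
  have hd : x % m = y % m := by rw [← gluingInt_ediv hM m P x, h, gluingInt_ediv hM]
  have hr : P * (x / m) % M = P * (y / m) % M := by
    rw [← gluingInt_emod, h, gluingInt_emod]
  have hdvd : M ∣ P * (y / m - x / m) := by
    rw [mul_sub]
    exact Int.ModEq.dvd hr
  obtain ⟨k, hk⟩ := hP.dvd_of_dvd_mul_left hdvd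
  refine Int.modEq_iff_dvd.mpr ⟨k, ?_⟩
  linear_combination m * hk + (Int.mul_ediv_add_emod x m) - (Int.mul_ediv_add_emod y m) - hd

theorem chainSigmaTwo_cast {M m P ℓ : ℕ} (hM : 0 < M) (hm : 0 < m) (hℓ : 0 < ℓ)
    {p q : ℕ} (hp : p - 1 = M) (hq : q - 1 = ℓ * m) (hP : p = ℓ * P) (c : ℕ) :
    (chainSigmaTwo p q ℓ c : ℤ) = gluingInt M m P (-c) := by
  have h1 : ℓ * m / ℓ = m := Nat.mul_div_cancel_left _ hℓ
  have h2 : p / ℓ = P := by rw [hP, Nat.mul_div_cancel_left _ hℓ]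
  have h3 : (-(c : ℤ) * (ℓ : ℤ)) / ((ℓ * m : ℕ) : ℤ) = -(c : ℤ) / m := by
    rw [mul_comm, Nat.cast_mul, Int.mul_ediv_mul_of_pos _ _ (by exact_mod_cast hℓ)]
  have h4 (a : ℤ) : (-(-(P : ℤ) * a % (M : ℤ))) % (M : ℤ) = P * a % M := by
    have := (Int.mod_modEq (-(P : ℤ) * a) M).neg
    rw [neg_mul, neg_neg] at this
    rw [neg_mul]
    exact this
  unfold chainSigmaTwo
  simp only [h1, h2, hp, hq, h3, h4]
  exact Int.toNat_of_nonneg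
    (gluingInt_nonneg (Int.natCast_pos.mpr hM) (Int.natCast_pos.mpr hm) P (-c))

theorem existsUnique_mul_add {M m c : ℕ} (hc : c < M * m) :
    ∃! ka : ℕ × ℕ, ka.1 < m ∧ ka.2 < M ∧ c = ka.1 * M + ka.2 := by
  have hM : 0 < M := Nat.pos_of_mul_pos_right (Nat.zero_lt_of_lt hc)
  refine ⟨(c / M, c % M), ⟨Nat.div_lt_of_lt_mul hc, Nat.mod_lt _ hM, ?_⟩, ?_⟩
  · exact (Nat.div_add_mod' c M).symm
  · rintro ⟨k, a⟩ ⟨-, ha, rfl⟩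
    dsimp only at ha ⊢
    rw [add_comm, Nat.add_mul_div_right _ _ hM, Nat.add_mul_mod_self_right,
      Nat.div_eq_of_lt ha, Nat.mod_eq_of_lt ha, zero_add]

/-- For `p, q ≥ 2` and `ℓ` dividing `p` and `q−1`, with
`N = (p−1)(q−1)/ℓ`: every element of `{0,…,N−1}` is uniquely of the form `k(p−1)+a`
with `k < (q−1)/ℓ`, `a < p−1`; the map `σ₂` is a bijection of `{0,…,N−1}`, and
`τ_ℓ ∘ σ₂ ∘ τ_r = σ₂ ∘ t` on `{0,…,N−1}`, where `t(c) = (c − q) mod N`. -/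
theorem chain_gluing_permutation_identity
    (p q ℓ N : ℕ) (hp : 2 ≤ p) (hq : 2 ≤ q) (hℓ : 1 ≤ ℓ)
    (hℓp : ℓ ∣ p) (hℓq : ℓ ∣ (q - 1)) (hN : N = (p - 1) * (q - 1) / ℓ) :
    (∀ c < N, ∃! ka : ℕ × ℕ,
      ka.1 < (q - 1) / ℓ ∧ ka.2 < p - 1 ∧ c = ka.1 * (p - 1) + ka.2) ∧
    Set.BijOn (chainSigmaTwo p q ℓ) (Set.Iio N) (Set.Iio N) ∧
    ∀ c < N, chainTauL p (chainSigmaTwo p q ℓ (chainTauR N c))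
      = chainSigmaTwo p q ℓ (chainT q N c) := by
  obtain ⟨m, hm⟩ := hℓq
  obtain ⟨P, hP⟩ := hℓp
  obtain ⟨M, hM⟩ : ∃ M, p - 1 = M := ⟨_, rfl⟩
  have hM0 : 0 < M := by omega
  have hm0 : 0 < m := Nat.pos_of_ne_zero (by rintro rfl; omega)
  have hMZ : (0 : ℤ) < M := by exact_mod_cast hM0
  have hmZ : (0 : ℤ) < m := by exact_mod_cast hm0
  have hdiv : (q - 1) / ℓ = m := by rw [hm, Nat.mul_div_cancel_left _ hℓ]
  have hNm : N = M * m := by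
    rw [hN, Nat.mul_div_assoc _ ⟨m, hm⟩, hdiv, hM]
  have hNZ : (N : ℤ) = M * m := by exact_mod_cast hNm
  have hN0 : (N : ℤ) ≠ 0 := by rw [hNZ]; positivity
  have hpZ : (ℓ : ℤ) * P = M + 1 := by
    have : ℓ * P = M + 1 := by omega
    exact_mod_cast this
  have hqZ : (q : ℤ) = ℓ * m + 1 := by
    have : q = ℓ * m + 1 := by omega
    exact_mod_cast this
  have hcop : IsCoprime (M : ℤ) P := ⟨-1, ℓ, by rw [hpZ]; ring⟩
  have hσ := chainSigmaTwo_cast hM0 hm0 hℓ hM hm hP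
  have hσ' (x : ℤ) : (chainSigmaTwo p q ℓ (x % N).toNat : ℤ) = gluingInt M m P (-x) := by
    rw [hσ, Int.toNat_of_nonneg (Int.emod_nonneg _ hN0)]
    refine gluingInt_congr hmZ P ?_
    rw [← hNZ]
    exact (Int.mod_modEq x N).neg
  have hmaps : Set.MapsTo (chainSigmaTwo p q ℓ) (Set.Iio N) (Set.Iio N) := by
    intro c _
    have := gluingInt_lt hMZ hmZ P (-c)
    rw [← hσ, ← hNZ] at this
    exact_mod_cast this
  have hinj : Set.InjOn (chainSigmaTwo p q ℓ) (Set.Iio N) := by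
    intro a ha b hb hab
    have h : gluingInt M m P (-a) = gluingInt M m P (-b) := by rw [← hσ, ← hσ, hab]
    have h2 := (modEq_of_gluingInt_eq hMZ hcop h).neg
    rw [neg_neg, neg_neg, ← hNZ, Int.natCast_modEq_iff] at h2
    exact h2.eq_of_lt_of_lt ha hb
  refine ⟨fun c hc => ?_, ⟨hmaps, hinj, ?_⟩, fun c _ => ?_⟩
  · rw [hdiv, hM]
    exact existsUnique_mul_add (hNm ▸ hc)
  · rw [← Finset.coe_Iio] at hmaps hinj ⊢
    exact Finset.surjOn_of_injOn_of_card_le _ hmaps hinj le_rfl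
  · zify
    unfold chainTauL chainTauR chainT
    rw [hM]
    push_cast
    rw [hσ', hσ', gluingInt_ediv hMZ, gluingInt_emod, Int.emod_add_emod]
    have hshift : -((c : ℤ) - q) = -((c : ℤ) - 1) + ℓ * m := by rw [hqZ]; ring
    rw [hshift, gluingInt_add_mul hmZ, mul_comm (P : ℤ) ℓ, hpZ, add_comm (M : ℤ) 1, ← add_assoc,
      Int.add_emod_right]
end

section
/- Let p, q ≥ 2 be integers and let ℓ ≥ 1 divide both p−1 and q−1. Then 2ℓ divides p·q − 1 − gcd(ℓ·(q−1), p+q−2). -/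
/-- The parity fact behind the integrality: `ℓab + a + b` and `gcd(ℓb, a+b)` have equal parity. -/
theorem even_loop_genus_reduced (a b ℓ : ℕ) :
    Even ((ℓ : ℤ) * a * b + a + b - (Nat.gcd (ℓ * b) (a + b) : ℤ)) := by
  have h : Even (Nat.gcd (ℓ * b) (a + b)) ↔ Even (ℓ * b) ∧ Even (a + b) := by
    simp only [even_iff_two_dvd, Nat.dvd_gcd_iff]
  simp only [Nat.even_mul, Nat.even_add] at h
  simp only [Int.even_sub, Int.even_add, Int.even_mul, Int.even_coe_nat, h]
  tauto

/-- If `p, q ≥ 2` and `ℓ ≥ 1` divides both `p−1` and `q−1`, then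
`2ℓ` divides `pq − 1 − gcd(ℓ(q−1), p+q−2)` (the integrality of the genus of the
mirror surface of a loop polynomial). -/
theorem loop_genus_integrality (p q ℓ : ℕ) (hp : 2 ≤ p) (hq : 2 ≤ q) (hℓ : 1 ≤ ℓ)
    (hℓp : ℓ ∣ (p - 1)) (hℓq : ℓ ∣ (q - 1)) :
    ((2 * ℓ : ℕ) : ℤ) ∣
      ((p : ℤ) * (q : ℤ) - 1 - (Nat.gcd (ℓ * (q - 1)) (p + q - 2) : ℤ)) := by
  obtain ⟨a, ha⟩ := hℓp
  obtain ⟨b, hb⟩ := hℓq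
  obtain rfl : p = ℓ * a + 1 := by omega
  obtain rfl : q = ℓ * b + 1 := by omega
  have hsum : ℓ * a + 1 + (ℓ * b + 1) - 2 = ℓ * (a + b) := by
    rw [mul_add]
    omega
  rw [hb, hsum, Nat.gcd_mul_left]
  obtain ⟨k, hk⟩ := (even_loop_genus_reduced a b ℓ).two_dvd
  refine ⟨k, ?_⟩
  push_cast at hk ⊢
  linear_combination (ℓ : ℤ) * hk
end

section
/- Let p, q ≥ 2 be integers and let ℓ ≥ 1 divide both p and q−1. Then 2ℓ divides p·q − p + ℓ − gcd(ℓ·q, p+q−1). -/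
theorem even_mul_add_one_sub_gcd (a b l : ℕ) :
    Even ((a : ℤ) * (l * b) + 1 - (Nat.gcd (l * b + 1) (a + b) : ℤ)) := by
  have hg : Even (Nat.gcd (l * b + 1) (a + b)) ↔ Even (l * b + 1) ∧ Even (a + b) := by
    simp only [even_iff_two_dvd, Nat.dvd_gcd_iff]
  simp only [Nat.even_add_one, Nat.even_mul, Nat.even_add] at hg
  simp only [Int.even_sub, Int.even_add_one, Int.even_mul, Int.even_coe_nat, hg]
  tauto

/-- If `p, q ≥ 2` and `ℓ ≥ 1` divides both `p` and `q−1`, then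
`2ℓ` divides `pq − p + ℓ − gcd(ℓq, p+q−1)` (the integrality of the genus of the
mirror surface of a chain polynomial). -/
theorem chain_genus_integrality (p q ℓ : ℕ) (hp : 2 ≤ p) (hq : 2 ≤ q) (hℓ : 1 ≤ ℓ)
    (hℓp : ℓ ∣ p) (hℓq : ℓ ∣ (q - 1)) :
    ((2 * ℓ : ℕ) : ℤ) ∣
      ((p : ℤ) * (q : ℤ) - (p : ℤ) + (ℓ : ℤ) - (Nat.gcd (ℓ * q) (p + q - 1) : ℤ)) := by
  obtain ⟨a, rfl⟩ := hℓp
  obtain ⟨b, hb⟩ := hℓq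
  obtain rfl : q = ℓ * b + 1 := by omega
  have hsum : ℓ * a + (ℓ * b + 1) - 1 = ℓ * (a + b) := by
    rw [← add_assoc, Nat.add_sub_cancel, mul_add]
  obtain ⟨c, hc⟩ := (even_mul_add_one_sub_gcd a b ℓ).two_dvd
  rw [hsum, Nat.gcd_mul_left]
  refine ⟨c, ?_⟩
  push_cast
  linear_combination (ℓ : ℤ) * hc
end

section
/- Let p, q ≥ 2 be integers and let ℓ ≥ 1 divide both p and q. Then 2ℓ divides (p−1)·(q−1) − 1 − gcd(ℓ·q, p+q). -/
/-- If `p, q ≥ 2` and `ℓ ≥ 1` divides both `p` and `q`, then `2ℓ`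
divides `(p−1)(q−1) − 1 − gcd(ℓq, p+q)` (the integrality of the genus of the mirror
surface of a Brieskorn–Pham polynomial). -/
theorem brieskorn_pham_genus_integrality (p q ℓ : ℕ) (hp : 2 ≤ p) (hq : 2 ≤ q)
    (hℓ : 1 ≤ ℓ) (hℓp : ℓ ∣ p) (hℓq : ℓ ∣ q) :
    ((2 * ℓ : ℕ) : ℤ) ∣
      (((p : ℤ) - 1) * ((q : ℤ) - 1) - 1 - (Nat.gcd (ℓ * q) (p + q) : ℤ)) := by
  obtain ⟨a, rfl⟩ := hℓp
  obtain ⟨b, rfl⟩ := hℓq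
  have hgcd : Nat.gcd (ℓ * (ℓ * b)) (ℓ * a + ℓ * b) = ℓ * Nat.gcd (ℓ * b) (a + b) := by
    rw [← mul_add, Nat.gcd_mul_left]
  have heven : Even ((ℓ : ℤ) * a * b - a - b - (Nat.gcd (ℓ * b) (a + b) : ℤ)) := by
    have hg : Even (Nat.gcd (ℓ * b) (a + b)) ↔ Even (ℓ * b) ∧ Even (a + b) := by
      simp only [even_iff_two_dvd, Nat.dvd_gcd_iff]
    simp only [Int.even_sub, Int.even_mul, Int.even_coe_nat, hg, Nat.even_mul, Nat.even_add]
    tauto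
  obtain ⟨k, hk⟩ := heven.two_dvd
  refine ⟨k, ?_⟩
  rw [hgcd]
  push_cast
  linear_combination (ℓ : ℤ) * hk
end
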